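/- arXiv:2101.05941 — 2 statements merged into one kernel-verified Lean document; each statement's English description precedes it below -/
import Mathlib

section
/- (Lemma 3, monotonicity of the constrained FIE cost.) Suppose Q − Σ_0⁻ is positive semidefinite, and Σ_0⁻, R are positive semidefinite. Fix t ≥ n+1 and measurements y_0, …, y_t ∈ ℝ^q, and suppose the constrained minimum of the cost J_s(α) = trace(z_sᵀ Σ_0⁻ z_s + α_sᵀ R α_s + Σ_{i=0}^{s−1} (z_iᵀ Q z_i + α_iᵀ R α_i)) over feasible control sequences is attained both at time s = t and at time s = t−1. Then trace(Σ_t^{cf}) ≥ trace(Σ_{t−1}^{cf}), i.e., the optimal cost at time t is at least the optimal cost at time t−1. -/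
open Matrix

/-- The dual process `z 0 = I + Cᵀ α 0`, `z (i+1) = Aᵀ z i + Cᵀ α (i+1)`. -/
noncomputable def dualZ {d q : ℕ} (A : Matrix (Fin d) (Fin d) ℝ) (C : Matrix (Fin q) (Fin d) ℝ)
    (α : ℕ → Matrix (Fin q) (Fin d) ℝ) : ℕ → Matrix (Fin d) (Fin d) ℝ
  | 0 => 1 + Cᵀ * α 0
  | (i + 1) => Aᵀ * dualZ A C α i + Cᵀ * α (i + 1)

/-- The estimate `x̂_s = z_sᵀ x̂_0⁻ − ∑_{i=0}^{s} α_iᵀ y_{s−i}`. -/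
noncomputable def mvEstimate {d q : ℕ} (A : Matrix (Fin d) (Fin d) ℝ)
    (C : Matrix (Fin q) (Fin d) ℝ) (α : ℕ → Matrix (Fin q) (Fin d) ℝ)
    (xhat0m : Fin d → ℝ) (y : ℕ → Fin q → ℝ) (s : ℕ) : Fin d → ℝ :=
  (dualZ A C α s)ᵀ.mulVec xhat0m - ∑ i ∈ Finset.range (s + 1), (α i)ᵀ.mulVec (y (s - i))

/-- Feasibility at time `s` for the CFIE: for every `j ∈ {0,…,s−n}`, the estimate
`x̂_{s−j}` lies in `X = {x : H x ≤ h}`. -/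
def mvFeasible {d q p : ℕ} (A : Matrix (Fin d) (Fin d) ℝ) (C : Matrix (Fin q) (Fin d) ℝ)
    (H : Matrix (Fin p) (Fin d) ℝ) (hvec : Fin p → ℝ) (n : ℕ)
    (xhat0m : Fin d → ℝ) (y : ℕ → Fin q → ℝ) (s : ℕ)
    (α : ℕ → Matrix (Fin q) (Fin d) ℝ) : Prop :=
  ∀ j ≤ s - n, H.mulVec (mvEstimate A C α xhat0m y (s - j)) ≤ hvec

/-- The cost `J_s(α) = trace(z_sᵀ Σ_0⁻ z_s + α_sᵀ R α_s + ∑_{i=0}^{s−1}(z_iᵀ Q z_i + α_iᵀ R α_i))`. -/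
noncomputable def mvCost {d q : ℕ} (A : Matrix (Fin d) (Fin d) ℝ) (C : Matrix (Fin q) (Fin d) ℝ)
    (S0m Q : Matrix (Fin d) (Fin d) ℝ) (R : Matrix (Fin q) (Fin q) ℝ)
    (s : ℕ) (α : ℕ → Matrix (Fin q) (Fin d) ℝ) : ℝ :=
  ((dualZ A C α s)ᵀ * S0m * dualZ A C α s + (α s)ᵀ * R * α s
    + ∑ i ∈ Finset.range s, ((dualZ A C α i)ᵀ * Q * dualZ A C α i + (α i)ᵀ * R * α i)).trace

/-- A control sequence feasible at time `s + 1` is feasible at time `s`. -/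
theorem mvFeasible_of_succ {d q p : ℕ} {A : Matrix (Fin d) (Fin d) ℝ}
    {C : Matrix (Fin q) (Fin d) ℝ} {H : Matrix (Fin p) (Fin d) ℝ} {hvec : Fin p → ℝ} {n s : ℕ}
    {xhat0m : Fin d → ℝ} {y : ℕ → Fin q → ℝ} {α : ℕ → Matrix (Fin q) (Fin d) ℝ} (hns : n ≤ s)
    (h : mvFeasible A C H hvec n xhat0m y (s + 1) α) :
    mvFeasible A C H hvec n xhat0m y s α := by
  intro j hj
  have := h (j + 1) (by omega)
  rwa [Nat.add_sub_add_right] at this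

/-- A congruence of a positive semidefinite real matrix has nonnegative trace. -/
theorem Matrix.PosSemidef.trace_transpose_mul_mul_nonneg {m k : Type*} [Fintype m] [Fintype k]
    {M : Matrix m m ℝ} (hM : M.PosSemidef) (B : Matrix m k ℝ) : 0 ≤ (Bᵀ * M * B).trace := by
  simpa only [conjTranspose_eq_transpose_of_trivial] using
    (hM.conjTranspose_mul_mul_same B).trace_nonneg

/-- For a fixed control sequence, the cost is nondecreasing in time. -/
theorem mvCost_le_succ {d q : ℕ} (A : Matrix (Fin d) (Fin d) ℝ) (C : Matrix (Fin q) (Fin d) ℝ)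
    {S0m Q : Matrix (Fin d) (Fin d) ℝ} {R : Matrix (Fin q) (Fin q) ℝ}
    (hQS : (Q - S0m).PosSemidef) (hS0m : S0m.PosSemidef) (hR : R.PosSemidef) (s : ℕ)
    (α : ℕ → Matrix (Fin q) (Fin d) ℝ) :
    mvCost A C S0m Q R s α ≤ mvCost A C S0m Q R (s + 1) α := by
  have hz := hS0m.trace_transpose_mul_mul_nonneg (dualZ A C α (s + 1))
  have hα := hR.trace_transpose_mul_mul_nonneg (α (s + 1))
  have hd := hQS.trace_transpose_mul_mul_nonneg (dualZ A C α s)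
  rw [Matrix.mul_sub, Matrix.sub_mul, trace_sub] at hd
  simp only [mvCost, Finset.sum_range_succ, trace_add]
  linarith

/-- Lemma 3, monotonicity of the constrained FIE cost: if `Q − Σ_0⁻ ⪰ 0` and
`Σ_0⁻, R ⪰ 0`, `t ≥ n+1`, and the constrained minimum of `J_s` over feasible control sequences
is attained at `s = t` (minimizer `αt`) and at `s = t−1` (minimizer `αtm`), then
`trace(Σ_t^{cf}) = J_t(αt) ≥ J_{t−1}(αtm) = trace(Σ_{t−1}^{cf})`. -/
theorem cfie_cost_monotone_increasing (d q p : ℕ)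
    (A : Matrix (Fin d) (Fin d) ℝ) (C : Matrix (Fin q) (Fin d) ℝ)
    (H : Matrix (Fin p) (Fin d) ℝ) (hvec : Fin p → ℝ)
    (S0m Q : Matrix (Fin d) (Fin d) ℝ) (R : Matrix (Fin q) (Fin q) ℝ)
    (hQS : (Q - S0m).PosSemidef) (hS0m : S0m.PosSemidef) (hR : R.PosSemidef)
    (n t : ℕ) (hnt : n + 1 ≤ t)
    (xhat0m : Fin d → ℝ) (y : ℕ → Fin q → ℝ)
    (αt αtm : ℕ → Matrix (Fin q) (Fin d) ℝ)
    (hfeas_t : mvFeasible A C H hvec n xhat0m y t αt)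
    (hopt_t : ∀ β, mvFeasible A C H hvec n xhat0m y t β →
      mvCost A C S0m Q R t αt ≤ mvCost A C S0m Q R t β)
    (hfeas_tm : mvFeasible A C H hvec n xhat0m y (t - 1) αtm)
    (hopt_tm : ∀ β, mvFeasible A C H hvec n xhat0m y (t - 1) β →
      mvCost A C S0m Q R (t - 1) αtm ≤ mvCost A C S0m Q R (t - 1) β) :
    mvCost A C S0m Q R (t - 1) αtm ≤ mvCost A C S0m Q R t αt := by
  obtain ⟨s, rfl⟩ : ∃ s, t = s + 1 := ⟨t - 1, by omega⟩
  rw [Nat.add_sub_cancel] at *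
  exact (hopt_tm αt (mvFeasible_of_succ (by omega) hfeas_t)).trans
    (mvCost_le_succ A C hQS hS0m hR s αt)
end

section
/- (Lemma 4, monotonicity under a Lyapunov condition.) Suppose Σ_0⁻, Q, R are positive semidefinite. Fix t ≥ n+1 and measurements y_0, …, y_t ∈ ℝ^q, suppose the constrained minimum of the cost J_s(α) = trace(z_sᵀ Σ_0⁻ z_s + α_sᵀ R α_s + Σ_{i=0}^{s−1} (z_iᵀ Q z_i + α_iᵀ R α_i)) over feasible control sequences is attained both at time s = t and at time s = t−1, with optimal sequence α_{0:t|t−1} (and dual states z_{i|t−1}) at time t−1. Suppose there exists K_t ∈ ℝ^{q×d} such that appending α_t = K_t z_{t−1|t−1} to the optimal sequence at time t−1 yields a control sequence feasible at time t, and such that, with Ã_t = Aᵀ + Cᵀ K_t, the matrix Ã_tᵀ Σ_0⁻ Ã_t − Σ_0⁻ + K_tᵀ R K_t + Q is negative semidefinite. Then trace(Σ_t^{cf}) ≤ trace(Σ_{t−1}^{cf}). -/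
open Matrix

theorem dualZ_congr {d q : ℕ} (A : Matrix (Fin d) (Fin d) ℝ) (C : Matrix (Fin q) (Fin d) ℝ)
    {α β : ℕ → Matrix (Fin q) (Fin d) ℝ} {m : ℕ} (h : ∀ i ≤ m, α i = β i) :
    dualZ A C α m = dualZ A C β m := by
  induction m with
  | zero => simp [dualZ, h 0 le_rfl]
  | succ m ih => simp [dualZ, ih fun i hi => h i (by omega), h (m + 1) le_rfl]

/-- The change in cost when the feedback control `K * z_s` is appended to `α` at time `s + 1`. -/
theorem mvCost_succ_feedback {d q : ℕ} (A : Matrix (Fin d) (Fin d) ℝ)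
    (C : Matrix (Fin q) (Fin d) ℝ) (S0m Q : Matrix (Fin d) (Fin d) ℝ)
    (R : Matrix (Fin q) (Fin q) ℝ) (s : ℕ) (α : ℕ → Matrix (Fin q) (Fin d) ℝ)
    (K : Matrix (Fin q) (Fin d) ℝ) :
    mvCost A C S0m Q R (s + 1) (fun i => if i = s + 1 then K * dualZ A C α s else α i) =
      mvCost A C S0m Q R s α +
        ((dualZ A C α s)ᵀ * ((Aᵀ + Cᵀ * K)ᵀ * S0m * (Aᵀ + Cᵀ * K) - S0m + Kᵀ * R * K + Q) *
          dualZ A C α s).trace := by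
  set β : ℕ → Matrix (Fin q) (Fin d) ℝ :=
    fun i => if i = s + 1 then K * dualZ A C α s else α i with hβ
  have hβα : ∀ i ≤ s, β i = α i := fun i hi => if_neg (by omega)
  have hβs : β (s + 1) = K * dualZ A C α s := if_pos rfl
  have hz : ∀ i ≤ s, dualZ A C β i = dualZ A C α i := fun i hi =>
    dualZ_congr A C fun j hj => hβα j (hj.trans hi)
  have hzs : dualZ A C β (s + 1) = (Aᵀ + Cᵀ * K) * dualZ A C α s := by
    rw [dualZ, hz s le_rfl, hβs, Matrix.add_mul, Matrix.mul_assoc]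
  have hsum : ∑ i ∈ Finset.range s,
        ((dualZ A C β i)ᵀ * Q * dualZ A C β i + (β i)ᵀ * R * β i) =
      ∑ i ∈ Finset.range s, ((dualZ A C α i)ᵀ * Q * dualZ A C α i + (α i)ᵀ * R * α i) :=
    Finset.sum_congr rfl fun i hi => by
      have hi' := (Finset.mem_range.mp hi).le
      rw [hz i hi', hβα i hi']
  unfold mvCost
  rw [Finset.sum_range_succ, hsum, hzs, hβs, hz s le_rfl, hβα s le_rfl, ← Matrix.trace_add]
  congr 1
  generalize Aᵀ + Cᵀ * K = B
  simp only [Matrix.transpose_mul, Matrix.mul_add, Matrix.add_mul, Matrix.mul_sub,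
    Matrix.sub_mul, Matrix.mul_assoc]
  abel

/-- Lemma 4, monotonicity under a Lyapunov condition: if `Σ_0⁻, Q, R ⪰ 0`,
`t ≥ n+1`, the constrained minima of `J_s` are attained at `s = t` (minimizer `αt`) and at
`s = t−1` (minimizer `αtm`), and there is `K` such that appending `α_t = K z_{t−1|t−1}` to
`αtm` yields a sequence feasible at time `t`, with
`Ãᵀ Σ_0⁻ Ã − Σ_0⁻ + Kᵀ R K + Q ⪯ 0` for `Ã = Aᵀ + Cᵀ K`, then
`trace(Σ_t^{cf}) = J_t(αt) ≤ J_{t−1}(αtm) = trace(Σ_{t−1}^{cf})`. -/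
theorem cfie_cost_monotone_decreasing (d q p : ℕ)
    (A : Matrix (Fin d) (Fin d) ℝ) (C : Matrix (Fin q) (Fin d) ℝ)
    (H : Matrix (Fin p) (Fin d) ℝ) (hvec : Fin p → ℝ)
    (S0m Q : Matrix (Fin d) (Fin d) ℝ) (R : Matrix (Fin q) (Fin q) ℝ)
    (hS0m : S0m.PosSemidef) (hQ : Q.PosSemidef) (hR : R.PosSemidef)
    (n t : ℕ) (hnt : n + 1 ≤ t)
    (xhat0m : Fin d → ℝ) (y : ℕ → Fin q → ℝ)
    (αt αtm : ℕ → Matrix (Fin q) (Fin d) ℝ)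
    (hfeas_t : mvFeasible A C H hvec n xhat0m y t αt)
    (hopt_t : ∀ β, mvFeasible A C H hvec n xhat0m y t β →
      mvCost A C S0m Q R t αt ≤ mvCost A C S0m Q R t β)
    (hfeas_tm : mvFeasible A C H hvec n xhat0m y (t - 1) αtm)
    (hopt_tm : ∀ β, mvFeasible A C H hvec n xhat0m y (t - 1) β →
      mvCost A C S0m Q R (t - 1) αtm ≤ mvCost A C S0m Q R (t - 1) β)
    (K : Matrix (Fin q) (Fin d) ℝ)
    (hKfeas : mvFeasible A C H hvec n xhat0m y t
      (fun i => if i = t then K * dualZ A C αtm (t - 1) else αtm i))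
    (hLyap : (-((Aᵀ + Cᵀ * K)ᵀ * S0m * (Aᵀ + Cᵀ * K) - S0m + Kᵀ * R * K + Q)).PosSemidef) :
    mvCost A C S0m Q R t αt ≤ mvCost A C S0m Q R (t - 1) αtm := by
  obtain ⟨s, rfl⟩ : ∃ s, t = s + 1 := ⟨t - 1, by omega⟩
  refine (hopt_t _ hKfeas).trans ?_
  simp only [Nat.add_sub_cancel]
  rw [mvCost_succ_feedback]
  have htrace := (hLyap.conjTranspose_mul_mul_same (dualZ A C αtm s)).trace_nonneg
  rw [Matrix.conjTranspose_eq_transpose_of_trivial, Matrix.mul_neg, Matrix.neg_mul,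
    Matrix.trace_neg] at htrace
  linarith
end
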